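/- Let B ∈ W^{1,2}(A_r) where A_r = B(3r)\B(2r) ⊂ ℝ³ is an annulus, r ≥ 1. Suppose the weighted mean satisfies |B_{A_r,ζ}| ≤ c r^{−5/6} for a suitable cutoff ζ. Then r^{−1} ∫_{A_r} |B|² |∇B| dx ≤ c r^{−1/2} (∫_{A_r} |∇B|² dx)^{3/2} + c r^{−7/6} (∫_{A_r} |∇B|² dx)^{1/2}. In particular, if ∫_{ℝ³}|∇B|² dx < ∞ then r^{−1} ∫_{A_r} |B|²|∇B| dx → 0 as r → ∞. -/

import Mathlib

open MeasureTheory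

noncomputable abbrev E3 : Type := EuclideanSpace ℝ (Fin 3)

/-- The annulus `A_r = B(3r) \ B(2r)` in `ℝ³`. -/
def annulus (r : ℝ) : Set E3 :=
  Metric.ball (0 : E3) (3 * r) \ Metric.ball (0 : E3) (2 * r)

open Set ENNReal

theorem lintegral_mul_sq_le {α : Type*} [MeasurableSpace α] (μ : Measure α) {f g : α → ℝ≥0∞}
    (hf : AEMeasurable f μ) (hg : AEMeasurable g μ) :
    (∫⁻ a, f a * g a ∂μ) ^ 2 ≤ (∫⁻ a, f a ^ 2 ∂μ) * ∫⁻ a, g a ^ 2 ∂μ := by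
  have h := ENNReal.lintegral_mul_le_Lp_mul_Lq μ Real.HolderConjugate.two_two hf hg
  simp only [Pi.mul_apply, ENNReal.rpow_two] at h
  calc (∫⁻ a, f a * g a ∂μ) ^ 2
      ≤ ((∫⁻ a, f a ^ 2 ∂μ) ^ (1 / 2 : ℝ) * (∫⁻ a, g a ^ 2 ∂μ) ^ (1 / 2 : ℝ)) ^ 2 := by gcongr
    _ = _ := by
      rw [mul_pow, ← ENNReal.rpow_mul_natCast, ← ENNReal.rpow_mul_natCast]
      norm_num

theorem lintegral_pow_four_le {α : Type*} [MeasurableSpace α] (μ : Measure α) {f : α → ℝ≥0∞}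
    (hf : AEMeasurable f μ) :
    (∫⁻ a, f a ∂μ) ^ 4 ≤ μ univ ^ 3 * ∫⁻ a, f a ^ 4 ∂μ := by
  have h1 := lintegral_mul_sq_le μ (f := fun _ => 1) aemeasurable_const hf
  have h2 := lintegral_mul_sq_le μ (f := fun _ => 1) aemeasurable_const (hf.pow_const 2)
  simp only [one_mul, one_pow, lintegral_const, ← pow_mul, Nat.reduceMul] at h1 h2
  calc (∫⁻ a, f a ∂μ) ^ 4 = ((∫⁻ a, f a ∂μ) ^ 2) ^ 2 := by ring
    _ ≤ (μ univ * ∫⁻ a, f a ^ 2 ∂μ) ^ 2 := by gcongr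
    _ = μ univ ^ 2 * (∫⁻ a, f a ^ 2 ∂μ) ^ 2 := by ring
    _ ≤ μ univ ^ 2 * (μ univ * ∫⁻ a, f a ^ 4 ∂μ) := by gcongr
    _ = _ := by ring

theorem ENNReal.add_pow_le_two_pow_mul (a b : ℝ≥0∞) (n : ℕ) :
    (a + b) ^ n ≤ 2 ^ n * (a ^ n + b ^ n) := by
  rcases le_total a b with h | h
  · calc (a + b) ^ n ≤ (2 * b) ^ n := by rw [two_mul]; gcongr
      _ ≤ _ := by rw [mul_pow]; gcongr; exact le_add_self
  · calc (a + b) ^ n ≤ (2 * a) ^ n := by rw [two_mul]; gcongr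
      _ ≤ _ := by rw [mul_pow]; gcongr; exact le_self_add

theorem lintegral_comp_smul_add (k : E3 → ℝ≥0∞) (hk : Measurable k) {t : ℝ} (ht : 0 < t)
    (c : E3) : ∫⁻ w, k (t • w + c) = ENNReal.ofReal (t ^ 3)⁻¹ * ∫⁻ z, k z := by
  have h1 : ∫⁻ w, k (t • w + c) = ∫⁻ z, k (z + c) ∂(Measure.map (t • ·) (volume : Measure E3)) := by
    rw [lintegral_map (by fun_prop) (by fun_prop)]
  rw [h1, Measure.map_addHaar_smul _ ht.ne', lintegral_smul_measure, smul_eq_mul,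
    lintegral_add_right_eq_self]
  simp [abs_of_pos ht]

theorem volume_ball_E3 (x : E3) {t : ℝ} (ht : 0 ≤ t) :
    volume (Metric.ball x t) = ENNReal.ofReal (t ^ 3) * volume (Metric.ball (0 : E3) 1) := by
  rw [Measure.addHaar_ball _ _ ht]; simp

theorem lintegral_ball_comp_le {h : E3 → ℝ≥0∞} (hh : Measurable h) {x v : E3} (hv : ‖v‖ ≤ 1 / 2)
    {t : ℝ} (ht : 0 < t) :
    ∫⁻ w in Metric.ball (0 : E3) (1 / 2), h (x + t • (v + w))
      ≤ ENNReal.ofReal (t ^ 3)⁻¹ * ∫⁻ z in Metric.ball x t, h z := by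
  rw [← lintegral_indicator Metric.isOpen_ball.measurableSet,
    ← lintegral_indicator Metric.isOpen_ball.measurableSet,
    ← lintegral_comp_smul_add _ (hh.indicator Metric.isOpen_ball.measurableSet) ht (x + t • v)]
  apply lintegral_mono
  intro w
  by_cases hw : w ∈ Metric.ball (0 : E3) (1 / 2)
  · have e : t • w + (x + t • v) = x + t • (v + w) := by module
    beta_reduce
    rw [indicator_of_mem hw, e, indicator_of_mem]
    rw [mem_ball_zero_iff] at hw
    rw [mem_ball_iff_norm, add_sub_cancel_left, norm_smul, Real.norm_of_nonneg ht.le]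
    have := norm_add_le v w
    nlinarith
  · rw [indicator_of_notMem hw]; exact zero_le

theorem lintegral_Ioo_rpow_ne_top {p : ℝ} (hp : -1 < p) :
    ∫⁻ t in Ioo (0 : ℝ) 1, ENNReal.ofReal (t ^ p) ≠ ⊤ := by
  have h : IntegrableOn (fun t : ℝ => t ^ p) (Ioo 0 1) :=
    (intervalIntegral.integrableOn_Ioo_rpow_iff one_pos).2 hp
  exact h.lintegral_lt_top.ne

/-- The cone potential of `h` with apex `x` and base the ball of radius `1/2` about `x + φ x`. -/
noncomputable def conePotential (φ : E3 → E3) (p : ℝ) (h : E3 → ℝ≥0∞) (x : E3) : ℝ≥0∞ :=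
  ∫⁻ q : ℝ × E3, ENNReal.ofReal (q.1 ^ p) * h (x + q.1 • (φ x + q.2))
    ∂((volume.restrict (Ioo (0 : ℝ) 1)).prod (volume.restrict (Metric.ball (0 : E3) (1 / 2))))

theorem conePotential_le_lintegral {φ : E3 → E3} {h : E3 → ℝ≥0∞} (hh : Measurable h) (p : ℝ)
    {x : E3} (hx : ‖φ x‖ ≤ 1 / 2) :
    conePotential φ p h x ≤
      ∫⁻ t in Ioo (0 : ℝ) 1, ENNReal.ofReal (t ^ (p - 3)) * ∫⁻ z in Metric.ball x t, h z := by
  unfold conePotential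
  rw [lintegral_prod _ (by fun_prop)]
  apply setLIntegral_mono' measurableSet_Ioo
  intro t ht
  have e : ENNReal.ofReal (t ^ (p - 3)) = ENNReal.ofReal (t ^ p) * ENNReal.ofReal (t ^ 3)⁻¹ := by
    rw [← ENNReal.ofReal_mul (Real.rpow_nonneg ht.1.le _), Real.rpow_sub ht.1, div_eq_mul_inv]
    norm_cast
  simp only
  rw [lintegral_const_mul _ (by fun_prop), e, mul_assoc]
  gcongr
  exact lintegral_ball_comp_le hh hx ht.1

theorem conePotential_le {φ : E3 → E3} {h : E3 → ℝ≥0∞} (hh : Measurable h) (p : ℝ)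
    {x : E3} (hx : ‖φ x‖ ≤ 1 / 2) :
    conePotential φ p h x ≤
      (∫⁻ t in Ioo (0 : ℝ) 1, ENNReal.ofReal (t ^ (p - 3))) * ∫⁻ z, h z := by
  refine (conePotential_le_lintegral hh p hx).trans ?_
  rw [← lintegral_mul_const _ (by fun_prop)]
  gcongr
  exact Measure.restrict_le_self

theorem lintegral_conePotential_le {φ : E3 → E3} {h : E3 → ℝ≥0∞} (hh : Measurable h) (p : ℝ)
    {S : Set E3} (hS : MeasurableSet S) (hφ : ∀ x ∈ S, ‖φ x‖ ≤ 1 / 2) :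
    ∫⁻ x in S, conePotential φ p h x ≤
      (∫⁻ t in Ioo (0 : ℝ) 1, ENNReal.ofReal (t ^ p)) *
        (volume (Metric.ball (0 : E3) 1) * ∫⁻ z, h z) := by
  have hm : Measurable fun q : (E3 × ℝ) × E3 =>
      (Metric.ball q.1.1 q.1.2).indicator h q.2 := by
    have hs : MeasurableSet {q : (E3 × ℝ) × E3 | dist q.2 q.1.1 < q.1.2} :=
      measurableSet_lt (by fun_prop) (by fun_prop)
    exact (hh.comp measurable_snd).indicator hs
  have hb (x : E3) (t : ℝ) : ∫⁻ z in Metric.ball x t, h z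
      = ∫⁻ z, (Metric.ball x t).indicator h z :=
    (lintegral_indicator Metric.isOpen_ball.measurableSet _).symm
  calc ∫⁻ x in S, conePotential φ p h x
      ≤ ∫⁻ x in S, ∫⁻ t in Ioo (0 : ℝ) 1,
          ENNReal.ofReal (t ^ (p - 3)) * ∫⁻ z in Metric.ball x t, h z :=
        setLIntegral_mono' hS fun x hx => conePotential_le_lintegral hh p (hφ x hx)
    _ ≤ ∫⁻ x, ∫⁻ t in Ioo (0 : ℝ) 1,
          ENNReal.ofReal (t ^ (p - 3)) * ∫⁻ z, (Metric.ball x t).indicator h z := by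
        simp only [hb]
        exact lintegral_mono' Measure.restrict_le_self le_rfl
    _ = ∫⁻ t in Ioo (0 : ℝ) 1, ∫⁻ x,
          ENNReal.ofReal (t ^ (p - 3)) * ∫⁻ z, (Metric.ball x t).indicator h z := by
        apply lintegral_lintegral_swap
        refine Measurable.aemeasurable ?_
        exact Measurable.mul (by fun_prop) hm.lintegral_prod_right'
    _ = ∫⁻ t in Ioo (0 : ℝ) 1, ENNReal.ofReal (t ^ p) *
        (volume (Metric.ball (0 : E3) 1) * ∫⁻ z, h z) := by
        apply setLIntegral_congr_fun measurableSet_Ioo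
        intro t ht
        have hmt : Measurable fun q : E3 × E3 => (Metric.ball q.1 t).indicator h q.2 :=
          hm.comp (f := fun q : E3 × E3 => ((q.1, t), q.2)) (by fun_prop)
        have e : ENNReal.ofReal (t ^ p)
            = ENNReal.ofReal (t ^ (p - 3)) * ENNReal.ofReal (t ^ 3) := by
          rw [← ENNReal.ofReal_mul (Real.rpow_nonneg ht.1.le _), ← Real.rpow_add_natCast ht.1.ne']
          norm_num
        have hz (z : E3) : ∫⁻ x, (Metric.ball x t).indicator h z
            = ENNReal.ofReal (t ^ 3) * volume (Metric.ball (0 : E3) 1) * h z := by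
          have : ∀ x, (Metric.ball x t).indicator h z
              = (Metric.ball z t).indicator (fun _ => h z) x := by
            intro x
            simp only [indicator, Metric.mem_ball, dist_comm]
          simp only [this]
          rw [lintegral_indicator_const Metric.isOpen_ball.measurableSet,
            volume_ball_E3 _ ht.1.le, mul_comm]
        simp only
        rw [lintegral_const_mul _ hmt.lintegral_prod_right', lintegral_lintegral_swap
          hmt.aemeasurable]
        simp only [hz]
        rw [lintegral_const_mul _ hh, e]
        ring
    _ = _ := by rw [lintegral_mul_const _ (by fun_prop)]

theorem conePotential_sq_le {φ : E3 → E3} {f g : E3 → ℝ≥0∞} (hf : Measurable f)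
    (hg : Measurable g) (a b : ℝ) (x : E3) :
    conePotential φ ((a + b) / 2) (fun z => f z * g z) x ^ 2 ≤
      conePotential φ a (fun z => f z ^ 2) x * conePotential φ b (fun z => g z ^ 2) x := by
  have key := lintegral_mul_sq_le
    ((volume.restrict (Ioo (0 : ℝ) 1)).prod (volume.restrict (Metric.ball (0 : E3) (1 / 2))))
    (f := fun q => ENNReal.ofReal (q.1 ^ (a / 2)) * f (x + q.1 • (φ x + q.2)))
    (g := fun q => ENNReal.ofReal (q.1 ^ (b / 2)) * g (x + q.1 • (φ x + q.2)))
    (by fun_prop) (by fun_prop)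
  have hae : ∀ᵐ q : ℝ × E3 ∂((volume.restrict (Ioo (0 : ℝ) 1)).prod
      (volume.restrict (Metric.ball (0 : E3) (1 / 2)))), 0 < q.1 := by
    have := (ae_restrict_mem (μ := (volume : Measure ℝ)) (measurableSet_Ioo (a := 0) (b := 1)))
    exact (Measure.quasiMeasurePreserving_fst.ae this).mono fun q hq => hq.1
  have hsq (c : ℝ) {t : ℝ} (ht : 0 < t) :
      ENNReal.ofReal (t ^ (c / 2)) ^ 2 = ENNReal.ofReal (t ^ c) := by
    rw [← ENNReal.ofReal_pow (Real.rpow_nonneg ht.le _), ← Real.rpow_mul_natCast ht.le]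
    norm_num
  unfold conePotential
  convert key using 2
  · apply lintegral_congr_ae
    filter_upwards [hae] with q hq
    rw [add_div, Real.rpow_add hq, ENNReal.ofReal_mul (Real.rpow_nonneg hq.le _)]
    ring
  · apply lintegral_congr_ae
    filter_upwards [hae] with q hq
    rw [mul_pow, hsq a hq]
  · apply lintegral_congr_ae
    filter_upwards [hae] with q hq
    rw [mul_pow, hsq b hq]

theorem exists_lintegral_conePotential_pow_four_le :
    ∃ C : ℝ≥0∞, C ≠ ⊤ ∧ ∀ (φ : E3 → E3) (g : E3 → ℝ≥0∞) (S : Set E3), Measurable φ →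
      Measurable g → MeasurableSet S → (∀ x ∈ S, ‖φ x‖ ≤ 1 / 2) →
      ∫⁻ x in S, conePotential φ 0 g x ^ 4 ≤ C * (∫⁻ z, g z ^ 2) ^ 2 := by
  set I : ℝ → ℝ≥0∞ := fun p => ∫⁻ t in Ioo (0 : ℝ) 1, ENNReal.ofReal (t ^ p) with hI
  have hI' {p : ℝ} (hp : -1 < p) : I p ≠ ⊤ := lintegral_Ioo_rpow_ne_top hp
  set ω := volume (Metric.ball (0 : E3) 1) with hω
  have hω_top : ω ≠ ⊤ := measure_ball_lt_top.ne
  set M : ℝ≥0∞ := I (-7 / 8) * volume (Metric.ball (0 : E3) (1 / 2)) with hM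
  refine ⟨M ^ 2 * (I (-3 / 4) * ω * I (-1 / 2)), ?_, ?_⟩
  · have h1 := hI' (p := -7 / 8) (by norm_num)
    have h2 := hI' (p := -3 / 4) (by norm_num)
    have h3 := hI' (p := -1 / 2) (by norm_num)
    have h4 : volume (Metric.ball (0 : E3) (1 / 2)) ≠ ⊤ := measure_ball_lt_top.ne
    finiteness
  intro φ g S hφm hg hS hφ
  have hpt (x : E3) (hx : x ∈ S) : conePotential φ 0 g x ^ 4 ≤
      M ^ 2 * (I (-1 / 2) * ∫⁻ z, g z ^ 2) * conePotential φ (-3 / 4) (fun z => g z ^ 2) x := by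
    have h1 := conePotential_sq_le (φ := φ) (f := fun _ => 1) measurable_const hg (-7 / 8) (7 / 8) x
    have h2 := conePotential_sq_le (φ := φ) hg hg (-3 / 4) (5 / 2) x
    have h3 : conePotential φ (-7 / 8) (fun _ => 1 ^ 2) x = M := by
      unfold conePotential
      simp only [one_pow, mul_one]
      rw [lintegral_prod _ (by fun_prop)]
      simp only [lintegral_const, Measure.restrict_apply_univ]
      rw [lintegral_mul_const _ (by fun_prop)]
    have h4 : conePotential φ (5 / 2) (fun z => g z ^ 2) x ≤ I (-1 / 2) * ∫⁻ z, g z ^ 2 := by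
      have := conePotential_le (φ := φ) (hg.pow_const 2) (5 / 2) (hφ x hx)
      norm_num at this ⊢
      exact this
    rw [h3] at h1
    norm_num at h1 h2
    simp only [← sq] at h2
    calc conePotential φ 0 g x ^ 4 = (conePotential φ 0 g x ^ 2) ^ 2 := by ring
      _ ≤ (M * conePotential φ (7 / 8) (fun z => g z ^ 2) x) ^ 2 := by gcongr
      _ = M ^ 2 * conePotential φ (7 / 8) (fun z => g z ^ 2) x ^ 2 := by ring
      _ ≤ M ^ 2 * (conePotential φ (-3 / 4) (fun z => g z ^ 2) x *
            conePotential φ (5 / 2) (fun z => g z ^ 2) x) := by gcongr; norm_num; exact h2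
      _ ≤ M ^ 2 * (conePotential φ (-3 / 4) (fun z => g z ^ 2) x *
            (I (-1 / 2) * ∫⁻ z, g z ^ 2)) := by gcongr
      _ = _ := by ring
  have hm : Measurable (conePotential φ (-3 / 4) (fun z => g z ^ 2)) := by
    unfold conePotential
    exact Measurable.lintegral_prod_right (by fun_prop)
  calc ∫⁻ x in S, conePotential φ 0 g x ^ 4
      ≤ ∫⁻ x in S, M ^ 2 * (I (-1 / 2) * ∫⁻ z, g z ^ 2) *
          conePotential φ (-3 / 4) (fun z => g z ^ 2) x := setLIntegral_mono' hS hpt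
    _ = M ^ 2 * (I (-1 / 2) * ∫⁻ z, g z ^ 2) *
          ∫⁻ x in S, conePotential φ (-3 / 4) (fun z => g z ^ 2) x := lintegral_const_mul _ hm
    _ ≤ M ^ 2 * (I (-1 / 2) * ∫⁻ z, g z ^ 2) * (I (-3 / 4) * (ω * ∫⁻ z, g z ^ 2)) := by
        gcongr
        exact lintegral_conePotential_le (hg.pow_const 2) _ hS hφ
    _ = _ := by ring

theorem enorm_sub_le_lintegral_path {F : Type*} [NormedAddCommGroup F] [NormedSpace ℝ F]
    {u : E3 → F} (hu : ContDiff ℝ 1 u)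
    {γ γ' : ℝ → E3} (hγ : ContDiff ℝ 1 γ) (hγ' : ∀ t, HasDerivAt γ (γ' t) t) {a b : ℝ}
    (hab : a ≤ b) {L : ℝ≥0∞} (hL : ∀ t, ‖γ' t‖ₑ ≤ L) :
    ‖u (γ b) - u (γ a)‖ₑ ≤ ∫⁻ t in Ioo a b, L * ‖fderiv ℝ u (γ t)‖ₑ := by
  have h := enorm_sub_le_lintegral_deriv_of_contDiffOn_Icc (hu.comp hγ).contDiffOn hab
  rw [← restrict_Ioo_eq_restrict_Icc] at h
  refine h.trans (lintegral_mono fun t => ?_)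
  have hd : HasDerivAt (u ∘ γ) (fderiv ℝ u (γ t) (γ' t)) t :=
    ((hu.differentiable (by norm_num)) (γ t)).hasFDerivAt.comp_hasDerivAt t (hγ' t)
  rw [hd.deriv, mul_comm]
  exact ((fderiv ℝ u (γ t)).le_opENorm _).trans (by gcongr; exact hL t)

theorem measurableSet_annulus (r : ℝ) : MeasurableSet (annulus r) :=
  Metric.isOpen_ball.measurableSet.diff Metric.isOpen_ball.measurableSet

theorem mem_annulus_iff {r : ℝ} {x : E3} : x ∈ annulus r ↔ 2 * r ≤ ‖x‖ ∧ ‖x‖ < 3 * r := by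
  simp [annulus, and_comm]

theorem volume_annulus_ne_top (r : ℝ) : volume (annulus r) ≠ ⊤ :=
  ((measure_mono sdiff_subset).trans_lt measure_ball_lt_top).ne

/-- The displacement from `x` to its radial projection on the sphere of radius `5/2`. -/
noncomputable def radialShift (x : E3) : E3 := (5 / 2 * ‖x‖⁻¹ - 1) • x

theorem measurable_radialShift : Measurable radialShift := by
  unfold radialShift; fun_prop

theorem norm_radialShift_le {x : E3} (hx : x ∈ annulus 1) : ‖radialShift x‖ ≤ 1 / 2 := by
  rw [mem_annulus_iff] at hx
  have h0 : 0 < ‖x‖ := by linarith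
  rw [radialShift, norm_smul, Real.norm_eq_abs, ← abs_of_pos h0, ← abs_mul, abs_of_pos h0,
    sub_mul, mul_assoc, inv_mul_cancel₀ h0.ne', abs_le]
  constructor <;> linarith

theorem norm_add_radialShift {x : E3} (hx : x ∈ annulus 1) : ‖x + radialShift x‖ = 5 / 2 := by
  rw [mem_annulus_iff] at hx
  have h0 : 0 < ‖x‖ := by linarith
  have : x + radialShift x = (5 / 2 * ‖x‖⁻¹) • x := by unfold radialShift; module
  rw [this, norm_smul, Real.norm_of_nonneg (by positivity), mul_assoc, inv_mul_cancel₀ h0.ne',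
    mul_one]

theorem mem_annulus_of_norm_sub_lt {x w : E3} {s ε : ℝ} (hs : ‖x‖ = s) (hw : ‖w‖ < ε)
    (h2 : 2 ≤ s - ε) (h3 : s + ε ≤ 3) : x + w ∈ annulus 1 := by
  rw [mem_annulus_iff]
  have h1 := norm_add_le x w
  have h4 := norm_sub_norm_le x (-w)
  rw [sub_neg_eq_add, norm_neg] at h4
  constructor <;> linarith

theorem cone_subset_annulus {x w : E3} (hx : x ∈ annulus 1) (hw : ‖w‖ < 1 / 2) {t : ℝ}
    (ht : t ∈ Ioo (0 : ℝ) 1) : x + t • (radialShift x + w) ∈ annulus 1 := by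
  have hx' := mem_annulus_iff.1 hx
  have h0 : 0 < ‖x‖ := by linarith
  have e : x + t • (radialShift x + w) = ((1 - t) + t * (5 / 2 * ‖x‖⁻¹)) • x + t • w := by
    unfold radialShift; module
  rw [e]
  have h1 : 0 < 1 - t := by linarith [ht.2]
  have ht0 := ht.1
  refine mem_annulus_of_norm_sub_lt (s := (1 - t) * ‖x‖ + t * (5 / 2)) (ε := t * (1 / 2))
    ?_ ?_ ?_ ?_
  · rw [norm_smul, Real.norm_of_nonneg (by positivity)]
    field_simp
  · rw [norm_smul, Real.norm_of_nonneg ht0.le]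
    gcongr
  · nlinarith
  · nlinarith

theorem exists_unit_orthogonal_decomposition (e e' : E3) (he : ‖e‖ = 1) (he' : ‖e'‖ = 1) :
    ∃ (f : E3) (θ : ℝ), ‖f‖ = 1 ∧ inner ℝ e f = 0 ∧ 0 ≤ θ ∧ θ ≤ Real.pi ∧
      e' = Real.cos θ • e + Real.sin θ • f := by
  set c : ℝ := inner ℝ e e' with hc
  have hcb : |c| ≤ 1 := by simpa [he, he'] using abs_real_inner_le_norm e e'
  rw [abs_le] at hcb
  set w := e' - c • e with hw
  have hew : inner ℝ e w = 0 := by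
    rw [hw, inner_sub_right, inner_smul_right, real_inner_self_eq_norm_sq, he, ← hc]; ring
  have hwn : ‖w‖ = Real.sin (Real.arccos c) := by
    rw [Real.sin_arccos, ← Real.sqrt_sq (norm_nonneg w)]
    congr 1
    rw [← real_inner_self_eq_norm_sq, hw, inner_sub_left, inner_sub_right, inner_sub_right,
      inner_smul_left, inner_smul_right, inner_smul_right, inner_smul_left,
      real_inner_self_eq_norm_sq, real_inner_self_eq_norm_sq, he, he', real_inner_comm, ← hc]
    simp
    ring
  have key : ∃ f : E3, ‖f‖ = 1 ∧ inner ℝ e f = 0 ∧ w = ‖w‖ • f := by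
    by_cases h0 : w = 0
    · have : Fact (Module.finrank ℝ E3 = 2 + 1) := ⟨by simp⟩
      have hne : e ≠ 0 := by rintro rfl; simp at he
      have hf : Module.finrank ℝ (ℝ ∙ e)ᗮ = 2 := Submodule.finrank_orthogonal_span_singleton hne
      have : Nontrivial (ℝ ∙ e)ᗮ := Module.nontrivial_of_finrank_pos (R := ℝ) (by omega)
      obtain ⟨⟨v, hv⟩, hv0⟩ := exists_ne (0 : (ℝ ∙ e)ᗮ)
      have hv0 : v ≠ 0 := fun h => hv0 (Subtype.ext h)
      rw [Submodule.mem_orthogonal_singleton_iff_inner_right] at hv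
      refine ⟨‖v‖⁻¹ • v, norm_smul_inv_norm hv0, ?_, by simp [h0]⟩
      rw [inner_smul_right, hv, mul_zero]
    · refine ⟨‖w‖⁻¹ • w, norm_smul_inv_norm h0, ?_, ?_⟩
      · rw [inner_smul_right, hew, mul_zero]
      · rw [smul_inv_smul₀ (norm_ne_zero_iff.2 h0)]
  obtain ⟨f, hf1, hf2, hf3⟩ := key
  refine ⟨f, Real.arccos c, hf1, hf2, Real.arccos_nonneg _, Real.arccos_le_pi _, ?_⟩
  rw [Real.cos_arccos hcb.1 hcb.2, ← hwn, ← hf3, hw]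
  abel

theorem measurable_enorm_fderiv {F : Type*} [NormedAddCommGroup F] [NormedSpace ℝ F]
    {u : E3 → F} (hu : ContDiff ℝ 1 u) : Measurable fun x => ‖fderiv ℝ u x‖ₑ :=
  (hu.continuous_fderiv (by norm_num)).enorm.measurable

theorem norm_circle_point {e f : E3} (he : ‖e‖ = 1) (hf : ‖f‖ = 1) (hef : inner ℝ e f = 0)
    {a b : ℝ} (hab : a ^ 2 + b ^ 2 = 1) : ‖a • e + b • f‖ = 1 := by
  have h : ‖a • e + b • f‖ ^ 2 = 1 := by
    rw [norm_add_sq_real, inner_smul_left, inner_smul_right, hef, norm_smul, norm_smul, he, hf]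
    simp [hab]
  nlinarith [norm_nonneg (a • e + b • f)]

theorem lintegral_enorm_sub_sphere_le {F : Type*} [NormedAddCommGroup F] [NormedSpace ℝ F]
    {u : E3 → F} (hu : ContDiff ℝ 1 u) {p q : E3} (hp : ‖p‖ = 5 / 2) (hq : ‖q‖ = 5 / 2) :
    ∫⁻ w in Metric.ball (0 : E3) (1 / 2), ‖u (q + w) - u (p + w)‖ₑ ≤
      ENNReal.ofReal (5 / 2 * Real.pi) * ∫⁻ z in annulus 1, ‖fderiv ℝ u z‖ₑ := by
  have hg := measurable_enorm_fderiv hu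
  obtain ⟨f, θ, hf, hef, hθ0, hθπ, hqe⟩ := exists_unit_orthogonal_decomposition
    ((2 / 5 : ℝ) • p) ((2 / 5 : ℝ) • q) (by rw [norm_smul, hp]; norm_num)
    (by rw [norm_smul, hq]; norm_num)
  set e := (2 / 5 : ℝ) • p with he
  have he1 : ‖e‖ = 1 := by rw [he, norm_smul, hp]; norm_num
  have hpe : p = (5 / 2 : ℝ) • e := by rw [he, smul_smul]; norm_num
  have hqe' : q = (5 / 2 : ℝ) • (Real.cos θ • e + Real.sin θ • f) := by
    rw [← hqe, smul_smul]; norm_num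
  set γ : ℝ → E3 := fun s => (5 / 2 : ℝ) • (Real.cos s • e + Real.sin s • f) with hγ
  have hγn (s : ℝ) : ‖γ s‖ = 5 / 2 := by
    rw [hγ, norm_smul, norm_circle_point he1 hf hef (Real.cos_sq_add_sin_sq s)]; norm_num
  have hγc : ContDiff ℝ 1 γ := by
    rw [hγ]
    exact (((Real.contDiff_cos.smul contDiff_const).add
      (Real.contDiff_sin.smul contDiff_const)).const_smul _)
  have hγd (s : ℝ) : HasDerivAt γ ((5 / 2 : ℝ) • ((-Real.sin s) • e + Real.cos s • f)) s :=
    (((Real.hasDerivAt_cos s).smul_const e).add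
      ((Real.hasDerivAt_sin s).smul_const f)).const_smul (5 / 2 : ℝ)
  have hpath (w : E3) : ‖u (q + w) - u (p + w)‖ₑ ≤
      ∫⁻ s in Ioo 0 θ, ENNReal.ofReal (5 / 2) * ‖fderiv ℝ u (γ s + w)‖ₑ := by
    have := enorm_sub_le_lintegral_path hu (γ := fun s => γ s + w) (hγc.add contDiff_const)
      (fun s => (hγd s).add_const w) hθ0 (L := ENNReal.ofReal (5 / 2)) (fun s => by
        rw [← ofReal_norm, norm_smul, norm_circle_point he1 hf hef
          (by rw [neg_sq]; exact Real.sin_sq_add_cos_sq s)]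
        norm_num)
    convert this using 4
    · rw [hqe']
    · simp [hγ, hpe]
  have hγm : Measurable γ := hγc.continuous.measurable
  calc ∫⁻ w in Metric.ball (0 : E3) (1 / 2), ‖u (q + w) - u (p + w)‖ₑ
      ≤ ∫⁻ w in Metric.ball (0 : E3) (1 / 2), ∫⁻ s in Ioo 0 θ,
          ENNReal.ofReal (5 / 2) * ‖fderiv ℝ u (γ s + w)‖ₑ := lintegral_mono fun w => hpath w
    _ = ∫⁻ s in Ioo 0 θ, ∫⁻ w in Metric.ball (0 : E3) (1 / 2),
          ENNReal.ofReal (5 / 2) * ‖fderiv ℝ u (γ s + w)‖ₑ :=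
        lintegral_lintegral_swap (Measurable.aemeasurable
          (measurable_const.mul (hg.comp ((hγm.comp measurable_snd).add measurable_fst))))
    _ ≤ ∫⁻ s in Ioo 0 θ, ENNReal.ofReal (5 / 2) * ∫⁻ z in annulus 1, ‖fderiv ℝ u z‖ₑ := by
        refine lintegral_mono fun s => ?_
        rw [lintegral_const_mul' _ _ ENNReal.ofReal_ne_top]
        gcongr ENNReal.ofReal (5 / 2) * ?_
        rw [← lintegral_indicator (measurableSet_annulus 1),
          ← lintegral_indicator Metric.isOpen_ball.measurableSet,
          ← lintegral_add_left_eq_self ((annulus 1).indicator fun z => ‖fderiv ℝ u z‖ₑ) (γ s)]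
        refine lintegral_mono fun w => ?_
        by_cases hw : w ∈ Metric.ball (0 : E3) (1 / 2)
        · rw [indicator_of_mem hw, indicator_of_mem]
          exact mem_annulus_of_norm_sub_lt (hγn s) (mem_ball_zero_iff.1 hw) (by norm_num)
            (by norm_num)
        · rw [indicator_of_notMem hw]; exact zero_le
    _ = ENNReal.ofReal (5 / 2) * (∫⁻ z in annulus 1, ‖fderiv ℝ u z‖ₑ) * ENNReal.ofReal θ := by
        rw [lintegral_const, Measure.restrict_apply_univ, Real.volume_Ioo, sub_zero]
    _ ≤ ENNReal.ofReal (5 / 2) * (∫⁻ z in annulus 1, ‖fderiv ℝ u z‖ₑ) *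
          ENNReal.ofReal Real.pi := by gcongr
    _ = _ := by rw [ENNReal.ofReal_mul (by norm_num)]; ring

theorem lintegral_enorm_sub_radial_le {F : Type*} [NormedAddCommGroup F] [NormedSpace ℝ F]
    {u : E3 → F} (hu : ContDiff ℝ 1 u) {x : E3} (hx : x ∈ annulus 1) :
    ∫⁻ w in Metric.ball (0 : E3) (1 / 2), ‖u (x + radialShift x + w) - u x‖ₑ ≤
      conePotential radialShift 0 ((annulus 1).indicator fun z => ‖fderiv ℝ u z‖ₑ) x := by
  have hg := (measurable_enorm_fderiv hu).indicator (measurableSet_annulus 1)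
  unfold conePotential
  simp only [Real.rpow_zero, ENNReal.ofReal_one, one_mul]
  rw [lintegral_prod_symm _ (by fun_prop)]
  refine setLIntegral_mono' Metric.isOpen_ball.measurableSet fun w hw => ?_
  rw [mem_ball_zero_iff] at hw
  have hd (t : ℝ) : HasDerivAt (fun t : ℝ => x + t • (radialShift x + w)) (radialShift x + w) t := by
    simpa using ((hasDerivAt_id t).smul_const (radialShift x + w)).const_add x
  have h := enorm_sub_le_lintegral_path hu (γ := fun t => x + t • (radialShift x + w))
    (contDiff_const.add (contDiff_id.smul contDiff_const)) hd zero_le_one (L := 1) (fun _ => by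
      rw [← ofReal_norm, ENNReal.ofReal_le_one]
      exact (norm_add_le _ _).trans (by linarith [norm_radialShift_le hx]))
  simp only [one_smul, zero_smul, add_zero, one_mul, ← add_assoc] at h
  refine h.trans (setLIntegral_mono' measurableSet_Ioo fun t ht => ?_)
  simp only
  rw [indicator_of_mem (cone_subset_annulus hx hw ht)]

/-- A subcritical Poincaré–Sobolev inequality on the unit annulus, in difference form. -/
theorem exists_lintegral_sub_pow_four_le (F : Type*) [NormedAddCommGroup F] [NormedSpace ℝ F] :
    ∃ C : ℝ≥0∞, C ≠ ⊤ ∧ ∀ u : E3 → F, ContDiff ℝ 1 u →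
      ∫⁻ x in annulus 1, ∫⁻ y in annulus 1, ‖u x - u y‖ₑ ^ 4 ≤
        C * (∫⁻ z in annulus 1, ‖fderiv ℝ u z‖ₑ ^ 2) ^ 2 := by
  obtain ⟨C, hC, hpot⟩ := exists_lintegral_conePotential_pow_four_le
  set V := volume (Metric.ball (0 : E3) (1 / 2)) with hV
  have hVt : V ≠ ⊤ := measure_ball_lt_top.ne
  have hV0 : V ≠ 0 := (Metric.measure_ball_pos _ _ (by norm_num)).ne'
  set m := volume (annulus 1) with hm
  have hmt : m ≠ ⊤ := volume_annulus_ne_top 1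
  set K := ENNReal.ofReal (5 / 2 * Real.pi) with hK
  refine ⟨(V ^ 4)⁻¹ * (2 ^ 4 * (m * C + 2 ^ 4 * (m ^ 2 * (K ^ 4 * m ^ 2) + m * C))), ?_, ?_⟩
  · have : (V ^ 4)⁻¹ ≠ ⊤ := ENNReal.inv_ne_top.2 (pow_ne_zero _ hV0)
    finiteness
  intro u hu
  set g : E3 → ℝ≥0∞ := fun z => ‖fderiv ℝ u z‖ₑ with hg
  have hgm : Measurable g := measurable_enorm_fderiv hu
  set T : E3 → ℝ≥0∞ := conePotential radialShift 0 ((annulus 1).indicator g) with hT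
  have hTm : Measurable T := by
    have := hgm.indicator (measurableSet_annulus 1)
    have := measurable_radialShift
    rw [hT]
    unfold conePotential
    exact Measurable.lintegral_prod_right (by fun_prop)
  set D := ∫⁻ z in annulus 1, g z ^ 2 with hD
  have hTD : ∫⁻ x in annulus 1, T x ^ 4 ≤ C * D ^ 2 := by
    refine (hpot radialShift _ _ measurable_radialShift
      (hgm.indicator (measurableSet_annulus 1)) (measurableSet_annulus 1)
      fun x hx => norm_radialShift_le hx).trans_eq ?_
    rw [hD, ← lintegral_indicator (measurableSet_annulus 1)]
    congr 3
    ext z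
    by_cases hz : z ∈ annulus 1 <;> simp [hz]
  have hG : (∫⁻ z in annulus 1, g z) ^ 4 ≤ m ^ 2 * D ^ 2 := by
    have := lintegral_mul_sq_le (volume.restrict (annulus 1)) (f := fun _ => 1) (g := g)
      aemeasurable_const hgm.aemeasurable
    simp only [one_mul, one_pow, lintegral_const, Measure.restrict_apply_univ] at this
    calc (∫⁻ z in annulus 1, g z) ^ 4 = ((∫⁻ z in annulus 1, g z) ^ 2) ^ 2 := by ring
      _ ≤ (m * D) ^ 2 := by gcongr
      _ = _ := by ring
  have hpt (x : E3) (hx : x ∈ annulus 1) (y : E3) (hy : y ∈ annulus 1) :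
      V ^ 4 * ‖u x - u y‖ₑ ^ 4 ≤
        2 ^ 4 * (T x ^ 4 + 2 ^ 4 * (K ^ 4 * (m ^ 2 * D ^ 2) + T y ^ 4)) := by
    have hcu := hu.continuous
    have h : V * ‖u x - u y‖ₑ ≤ T x + (K * (∫⁻ z in annulus 1, g z) + T y) := by
      calc V * ‖u x - u y‖ₑ
          = ∫⁻ w in Metric.ball (0 : E3) (1 / 2), ‖u x - u y‖ₑ := by
            rw [lintegral_const, Measure.restrict_apply_univ, mul_comm]
        _ ≤ ∫⁻ w in Metric.ball (0 : E3) (1 / 2), (‖u (x + radialShift x + w) - u x‖ₑ +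
              (‖u (y + radialShift y + w) - u (x + radialShift x + w)‖ₑ +
                ‖u (y + radialShift y + w) - u y‖ₑ)) := by
            refine lintegral_mono fun w => ?_
            have e : u x - u y = -(u (x + radialShift x + w) - u x) +
              (-(u (y + radialShift y + w) - u (x + radialShift x + w)) +
                (u (y + radialShift y + w) - u y)) := by abel
            rw [e]
            refine (enorm_add_le _ _).trans ?_
            rw [enorm_neg]
            gcongr
            refine (enorm_add_le _ _).trans ?_
            rw [enorm_neg]
        _ = (∫⁻ w in Metric.ball (0 : E3) (1 / 2), ‖u (x + radialShift x + w) - u x‖ₑ) +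
            ((∫⁻ w in Metric.ball (0 : E3) (1 / 2),
              ‖u (y + radialShift y + w) - u (x + radialShift x + w)‖ₑ) +
            ∫⁻ w in Metric.ball (0 : E3) (1 / 2), ‖u (y + radialShift y + w) - u y‖ₑ) := by
            rw [lintegral_add_left, lintegral_add_left]
            · exact Continuous.measurable (by fun_prop)
            · exact Continuous.measurable (by fun_prop)
        _ ≤ _ := by
            gcongr
            · exact lintegral_enorm_sub_radial_le hu hx
            · exact lintegral_enorm_sub_sphere_le hu (norm_add_radialShift hx)
                (norm_add_radialShift hy)
            · exact lintegral_enorm_sub_radial_le hu hy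
    calc V ^ 4 * ‖u x - u y‖ₑ ^ 4 = (V * ‖u x - u y‖ₑ) ^ 4 := by ring
      _ ≤ (T x + (K * (∫⁻ z in annulus 1, g z) + T y)) ^ 4 := by gcongr
      _ ≤ 2 ^ 4 * (T x ^ 4 + (K * (∫⁻ z in annulus 1, g z) + T y) ^ 4) :=
          ENNReal.add_pow_le_two_pow_mul _ _ _
      _ ≤ 2 ^ 4 * (T x ^ 4 + 2 ^ 4 * ((K * (∫⁻ z in annulus 1, g z)) ^ 4 + T y ^ 4)) := by
          gcongr; exact ENNReal.add_pow_le_two_pow_mul _ _ _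
      _ ≤ _ := by rw [mul_pow]; gcongr
  have hV4 (a b : ℝ≥0∞) : V ^ 4 * a ≤ b ↔ a ≤ (V ^ 4)⁻¹ * b :=
    ENNReal.mul_le_iff_le_inv (pow_ne_zero _ hV0) (ENNReal.pow_ne_top hVt)
  calc ∫⁻ x in annulus 1, ∫⁻ y in annulus 1, ‖u x - u y‖ₑ ^ 4
      ≤ ∫⁻ x in annulus 1, ∫⁻ y in annulus 1, (V ^ 4)⁻¹ *
          (2 ^ 4 * (T x ^ 4 + 2 ^ 4 * (K ^ 4 * (m ^ 2 * D ^ 2) + T y ^ 4))) :=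
        setLIntegral_mono' (measurableSet_annulus 1) fun x hx =>
          setLIntegral_mono' (measurableSet_annulus 1) fun y hy => (hV4 _ _).1 (hpt x hx y hy)
    _ = (V ^ 4)⁻¹ * (2 ^ 4 * (m * (∫⁻ x in annulus 1, T x ^ 4) +
          2 ^ 4 * (m ^ 2 * (K ^ 4 * (m ^ 2 * D ^ 2)) + m * ∫⁻ x in annulus 1, T x ^ 4))) := by
        have hin (x : E3) : ∫⁻ y in annulus 1, (V ^ 4)⁻¹ *
            (2 ^ 4 * (T x ^ 4 + 2 ^ 4 * (K ^ 4 * (m ^ 2 * D ^ 2) + T y ^ 4))) =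
            (V ^ 4)⁻¹ * (2 ^ 4 * (T x ^ 4 * m + 2 ^ 4 * (K ^ 4 * (m ^ 2 * D ^ 2) * m +
              ∫⁻ x in annulus 1, T x ^ 4))) := by
          rw [lintegral_const_mul _ (by fun_prop), lintegral_const_mul _ (by fun_prop),
            lintegral_add_left measurable_const, lintegral_const_mul _ (by fun_prop),
            lintegral_add_left measurable_const, lintegral_const, lintegral_const,
            Measure.restrict_apply_univ]
        simp only [hin]
        rw [lintegral_const_mul _ (by fun_prop), lintegral_const_mul _ (by fun_prop),
          lintegral_add_right _ measurable_const, lintegral_mul_const _ (by fun_prop),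
          lintegral_const, Measure.restrict_apply_univ]
        ring
    _ ≤ (V ^ 4)⁻¹ * (2 ^ 4 * (m * (C * D ^ 2) +
          2 ^ 4 * (m ^ 2 * (K ^ 4 * (m ^ 2 * D ^ 2)) + m * (C * D ^ 2)))) := by gcongr
    _ = _ := by ring

theorem lintegral_annulus_eq {r : ℝ} (hr : 0 < r) {f : E3 → ℝ≥0∞} (hf : Measurable f) :
    ∫⁻ x in annulus r, f x = ENNReal.ofReal r ^ 3 * ∫⁻ y in annulus 1, f (r • y) := by
  have h := lintegral_comp_smul_add _ (hf.indicator (measurableSet_annulus r)) hr 0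
  have hi : ∀ y : E3, (annulus r).indicator f (r • y + 0)
      = (annulus 1).indicator (fun y => f (r • y)) y := by
    intro y
    have : r • y ∈ annulus r ↔ y ∈ annulus 1 := by
      rw [mem_annulus_iff, mem_annulus_iff, norm_smul, Real.norm_of_nonneg hr.le, mul_comm r,
        mul_le_mul_iff_left₀ hr, mul_lt_mul_iff_left₀ hr]
      simp
    by_cases hy : y ∈ annulus 1
    · rw [add_zero, indicator_of_mem hy, indicator_of_mem (this.2 hy)]
    · rw [add_zero, indicator_of_notMem hy, indicator_of_notMem (this.not.2 hy)]
  simp only [hi] at h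
  rw [lintegral_indicator (measurableSet_annulus 1), lintegral_indicator (measurableSet_annulus r)]
    at h
  rw [h, ← mul_assoc, ← ENNReal.ofReal_pow hr.le, ← ENNReal.ofReal_mul (by positivity),
    mul_inv_cancel₀ (by positivity), ENNReal.ofReal_one, one_mul]

theorem volume_annulus {r : ℝ} (hr : 0 < r) :
    volume (annulus r) = ENNReal.ofReal r ^ 3 * volume (annulus 1) := by
  simpa using lintegral_annulus_eq hr (f := fun _ => 1) measurable_const

theorem lintegral_lintegral_annulus_eq {r : ℝ} (hr : 0 < r) {f : E3 × E3 → ℝ≥0∞}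
    (hf : Measurable f) :
    ∫⁻ x in annulus r, ∫⁻ y in annulus r, f (x, y) = ENNReal.ofReal r ^ 6 *
      ∫⁻ x in annulus 1, ∫⁻ y in annulus 1, f (r • x, r • y) := by
  have hin (x : E3) : ∫⁻ y in annulus r, f (x, y)
      = ENNReal.ofReal r ^ 3 * ∫⁻ y in annulus 1, f (x, r • y) :=
    lintegral_annulus_eq hr (hf.comp measurable_prodMk_left)
  have hout := lintegral_annulus_eq hr (f := fun x => ∫⁻ y in annulus r, f (x, y))
    hf.lintegral_prod_right'
  rw [hout]
  simp only [hin]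
  rw [lintegral_const_mul' _ _ (by finiteness), ← mul_assoc, ← pow_add]

theorem lintegral_enorm_fderiv_comp_smul_sq {F : Type*} [NormedAddCommGroup F] [NormedSpace ℝ F]
    {B : E3 → F} (hB : ContDiff ℝ 1 B) {r : ℝ} (hr : 0 < r) :
    ENNReal.ofReal r * ∫⁻ z in annulus 1, ‖fderiv ℝ (fun y => B (r • y)) z‖ₑ ^ 2 =
      ∫⁻ z in annulus r, ‖fderiv ℝ B z‖ₑ ^ 2 := by
  have hfd (z : E3) : ‖fderiv ℝ (fun y => B (r • y)) z‖ₑ ^ 2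
      = ENNReal.ofReal r ^ 2 * ‖fderiv ℝ B (r • z)‖ₑ ^ 2 := by
    rw [fderiv_comp_smul, enorm_smul, mul_pow, Real.enorm_of_nonneg hr.le]
  rw [lintegral_annulus_eq hr ((measurable_enorm_fderiv hB).pow_const 2)]
  simp only [hfd]
  rw [lintegral_const_mul' _ _ (by finiteness), ← mul_assoc, ← pow_succ']

theorem lintegral_sub_pow_four_annulus_le {F : Type*} [NormedAddCommGroup F] [NormedSpace ℝ F]
    {C : ℝ≥0∞} (hC : ∀ u : E3 → F, ContDiff ℝ 1 u →
      ∫⁻ x in annulus 1, ∫⁻ y in annulus 1, ‖u x - u y‖ₑ ^ 4 ≤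
        C * (∫⁻ z in annulus 1, ‖fderiv ℝ u z‖ₑ ^ 2) ^ 2)
    {B : E3 → F} (hB : ContDiff ℝ 1 B) {r : ℝ} (hr : 0 < r) :
    ∫⁻ x in annulus r, ∫⁻ y in annulus r, ‖B x - B y‖ₑ ^ 4 ≤
      ENNReal.ofReal r ^ 4 * C * (∫⁻ z in annulus r, ‖fderiv ℝ B z‖ₑ ^ 2) ^ 2 := by
  have hBc := hB.continuous
  have hm : Measurable fun q : E3 × E3 => ‖B q.1 - B q.2‖ₑ ^ 4 :=
    (Continuous.enorm (by fun_prop)).measurable.pow_const 4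
  have h := hC (fun y => B (r • y)) (hB.comp (contDiff_const_smul r))
  rw [lintegral_lintegral_annulus_eq hr hm, ← lintegral_enorm_fderiv_comp_smul_sq hB hr]
  calc _ ≤ ENNReal.ofReal r ^ 6 *
        (C * (∫⁻ z in annulus 1, ‖fderiv ℝ (fun y => B (r • y)) z‖ₑ ^ 2) ^ 2) := by gcongr
    _ = _ := by
      generalize ∫⁻ z in annulus 1, ‖fderiv ℝ (fun y => B (r • y)) z‖ₑ ^ 2 = K
      ring

theorem integrableOn_annulus {F : Type*} [NormedAddCommGroup F] {f : E3 → F} (hf : Continuous f)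
    (r : ℝ) : IntegrableOn f (annulus r) :=
  (hf.continuousOn.integrableOn_compact (isCompact_closedBall (0 : E3) (3 * r))).mono_set
    (sdiff_subset.trans Metric.ball_subset_closedBall)

theorem enorm_sub_weighted_mean_le {F : Type*} [NormedAddCommGroup F] [NormedSpace ℝ F]
    [CompleteSpace F] {B : E3 → F} (hB : Continuous B) {r : ℝ} {ζ : E3 → ℝ}
    (hζ : Measurable ζ) (h0 : ∀ x, 0 ≤ ζ x) (h1 : ∀ x, ζ x ≤ 1)
    (hM : 0 < ∫ x in annulus r, ζ x) (x : E3) :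
    ‖B x - (∫ x in annulus r, ζ x)⁻¹ • ∫ x in annulus r, ζ x • B x‖ₑ ≤
      ENNReal.ofReal (∫ x in annulus r, ζ x)⁻¹ * ∫⁻ y in annulus r, ‖B x - B y‖ₑ := by
  set M := ∫ x in annulus r, ζ x with hMdef
  have hζb (y : E3) : ‖ζ y‖ ≤ 1 := by rw [Real.norm_of_nonneg (h0 y)]; exact h1 y
  have hζi : IntegrableOn ζ (annulus r) := by
    by_contra h
    exact hM.ne' (integral_undef h)
  have hsm {G : E3 → F} (hG : Continuous G) : IntegrableOn (fun y => ζ y • G y) (annulus r) :=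
    (integrableOn_annulus hG r).bdd_smul 1 hζ.aestronglyMeasurable
      (Filter.Eventually.of_forall hζb)
  have e : B x - M⁻¹ • ∫ y in annulus r, ζ y • B y
      = M⁻¹ • ∫ y in annulus r, ζ y • (B x - B y) := by
    simp only [smul_sub]
    rw [integral_sub (hsm continuous_const) (hsm hB), integral_smul_const, smul_sub, ← hMdef,
      inv_smul_smul₀ hM.ne']
  rw [e, enorm_smul, Real.enorm_of_nonneg (inv_nonneg.2 hM.le)]
  gcongr
  refine (enorm_integral_le_lintegral_enorm _).trans (lintegral_mono fun y => ?_)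
  rw [enorm_smul]
  calc ‖ζ y‖ₑ * ‖B x - B y‖ₑ ≤ 1 * ‖B x - B y‖ₑ := by
        gcongr
        rw [← ofReal_norm, ENNReal.ofReal_le_one]
        exact hζb y
    _ = _ := one_mul _

theorem lintegral_sub_weighted_mean_pow_four_le {F : Type*} [NormedAddCommGroup F]
    [NormedSpace ℝ F] [CompleteSpace F]
    {C : ℝ≥0∞} (hC : ∀ u : E3 → F, ContDiff ℝ 1 u →
      ∫⁻ x in annulus 1, ∫⁻ y in annulus 1, ‖u x - u y‖ₑ ^ 4 ≤
        C * (∫⁻ z in annulus 1, ‖fderiv ℝ u z‖ₑ ^ 2) ^ 2)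
    {B : E3 → F} (hB : ContDiff ℝ 1 B) {r : ℝ} (hr : 0 < r) {ζ : E3 → ℝ}
    (hζ : Measurable ζ) (h0 : ∀ x, 0 ≤ ζ x) (h1 : ∀ x, ζ x ≤ 1) {c₀ : ℝ} (hc₀ : 0 < c₀)
    (hM : c₀ * r ^ 3 ≤ ∫ x in annulus r, ζ x) :
    ∫⁻ x in annulus r,
        ‖B x - (∫ x in annulus r, ζ x)⁻¹ • ∫ x in annulus r, ζ x • B x‖ₑ ^ 4 ≤
      ENNReal.ofReal c₀⁻¹ ^ 4 * volume (annulus 1) ^ 3 * C * ENNReal.ofReal r *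
        (∫⁻ z in annulus r, ‖fderiv ℝ B z‖ₑ ^ 2) ^ 2 := by
  have hBc := hB.continuous
  set M := ∫ x in annulus r, ζ x with hMdef
  set D := ∫⁻ z in annulus r, ‖fderiv ℝ B z‖ₑ ^ 2 with hD
  set ρ := ENNReal.ofReal r with hρ
  have hρ0 : ρ ≠ 0 := by rw [hρ]; simpa using hr
  have hM0 : 0 < M := lt_of_lt_of_le (by positivity) hM
  have hMinv : ρ ^ 3 * ENNReal.ofReal M⁻¹ ≤ ENNReal.ofReal c₀⁻¹ := by
    rw [hρ, ← ENNReal.ofReal_pow hr.le, ← ENNReal.ofReal_mul (by positivity)]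
    apply ENNReal.ofReal_le_ofReal
    rw [← div_eq_mul_inv, div_le_iff₀ hM0, inv_mul_eq_div, le_div_iff₀ hc₀]
    linarith
  set m := M⁻¹ • ∫ x in annulus r, ζ x • B x with hm
  have hpt (x : E3) : ρ ^ 12 * ‖B x - m‖ₑ ^ 4 ≤ ENNReal.ofReal c₀⁻¹ ^ 4 *
      ((ρ ^ 3 * volume (annulus 1)) ^ 3 * ∫⁻ y in annulus r, ‖B x - B y‖ₑ ^ 4) := by
    have hJ := lintegral_pow_four_le (volume.restrict (annulus r)) (f := fun y => ‖B x - B y‖ₑ)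
      (Continuous.enorm (by fun_prop)).measurable.aemeasurable
    rw [Measure.restrict_apply_univ, volume_annulus hr] at hJ
    calc ρ ^ 12 * ‖B x - m‖ₑ ^ 4 = (ρ ^ 3 * ‖B x - m‖ₑ) ^ 4 := by ring
      _ ≤ (ρ ^ 3 * (ENNReal.ofReal M⁻¹ * ∫⁻ y in annulus r, ‖B x - B y‖ₑ)) ^ 4 := by
          gcongr
          exact enorm_sub_weighted_mean_le hBc hζ h0 h1 hM0 x
      _ = (ρ ^ 3 * ENNReal.ofReal M⁻¹) ^ 4 * (∫⁻ y in annulus r, ‖B x - B y‖ₑ) ^ 4 := by ring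
      _ ≤ _ := by gcongr
  have h_mul : ρ ^ 12 * ∫⁻ x in annulus r, ‖B x - m‖ₑ ^ 4 ≤
      ρ ^ 12 * (ENNReal.ofReal c₀⁻¹ ^ 4 * volume (annulus 1) ^ 3 * C * ρ * D ^ 2) := by
    rw [← lintegral_const_mul' _ _ (by finiteness)]
    refine (lintegral_mono hpt).trans ?_
    have hv := volume_annulus_ne_top 1
    rw [lintegral_const_mul' _ _ (by finiteness), lintegral_const_mul' _ _ (by finiteness)]
    calc _ ≤ ENNReal.ofReal c₀⁻¹ ^ 4 * ((ρ ^ 3 * volume (annulus 1)) ^ 3 *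
          (ρ ^ 4 * C * D ^ 2)) := by
          gcongr
          exact lintegral_sub_pow_four_annulus_le hC hB hr
      _ = _ := by ring
  exact (ENNReal.mul_le_mul_iff_right (pow_ne_zero _ hρ0) (by finiteness)).1 h_mul

theorem lintegral_pow_four_annulus_le {F : Type*} [NormedAddCommGroup F] (B : E3 → F)
    (m : F) {r : ℝ} (hr : 0 < r) :
    ∫⁻ x in annulus r, ‖B x‖ₑ ^ 4 ≤ 2 ^ 4 * ((∫⁻ x in annulus r, ‖B x - m‖ₑ ^ 4) +
      ‖m‖ₑ ^ 4 * (ENNReal.ofReal r ^ 3 * volume (annulus 1))) := by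
  rw [← volume_annulus hr, ← Measure.restrict_apply_univ, ← lintegral_const,
    ← lintegral_add_right _ measurable_const, ← lintegral_const_mul' _ _ (by finiteness)]
  refine lintegral_mono fun x => ?_
  calc ‖B x‖ₑ ^ 4 = ‖(B x - m) + m‖ₑ ^ 4 := by rw [sub_add_cancel]
    _ ≤ (‖B x - m‖ₑ + ‖m‖ₑ) ^ 4 := by gcongr; exact enorm_add_le _ _
    _ ≤ _ := ENNReal.add_pow_le_two_pow_mul _ _ _

theorem ofReal_integral_mul_sq_le {F : Type*} [NormedAddCommGroup F] [NormedSpace ℝ F]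
    {B : E3 → F} (hB : ContDiff ℝ 1 B) (r : ℝ) :
    ENNReal.ofReal (∫ x in annulus r, ‖B x‖ ^ 2 * ‖fderiv ℝ B x‖) ^ 2 ≤
      (∫⁻ x in annulus r, ‖B x‖ₑ ^ 4) * ∫⁻ x in annulus r, ‖fderiv ℝ B x‖ₑ ^ 2 := by
  have hBc := hB.continuous
  have hdc := hB.continuous_fderiv (by norm_num)
  rw [ofReal_integral_eq_lintegral_ofReal (integrableOn_annulus (by fun_prop) r)
    (Filter.Eventually.of_forall fun x => by positivity)]
  have h := lintegral_mul_sq_le (volume.restrict (annulus r)) (f := fun x => ‖B x‖ₑ ^ 2)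
    (g := fun x => ‖fderiv ℝ B x‖ₑ) (hBc.enorm.measurable.pow_const 2).aemeasurable
    (measurable_enorm_fderiv hB).aemeasurable
  simp only [← pow_mul, Nat.reduceMul] at h
  convert h using 4 with x
  rw [ENNReal.ofReal_mul (by positivity), ENNReal.ofReal_pow (norm_nonneg _), ofReal_norm,
    ofReal_norm]

theorem ofReal_integral_fderiv_sq {F : Type*} [NormedAddCommGroup F] [NormedSpace ℝ F]
    {B : E3 → F} (hB : ContDiff ℝ 1 B) (r : ℝ) :
    ENNReal.ofReal (∫ x in annulus r, ‖fderiv ℝ B x‖ ^ 2) =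
      ∫⁻ x in annulus r, ‖fderiv ℝ B x‖ₑ ^ 2 := by
  have hdc := hB.continuous_fderiv (by norm_num)
  rw [ofReal_integral_eq_lintegral_ofReal (integrableOn_annulus (by fun_prop) r)
    (Filter.Eventually.of_forall fun x => by positivity)]
  congr with x
  rw [ENNReal.ofReal_pow (norm_nonneg _), ofReal_norm]

theorem inv_mul_le_of_sq_le {X G r a b : ℝ} (hG : 0 ≤ G) (hr : 0 < r) (ha : 0 ≤ a)
    (hb : 0 ≤ b) (h : X ^ 2 ≤ (a * r * G ^ 2 + b * r ^ (-(1 : ℝ) / 3)) * G) :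
    r⁻¹ * X ≤ (√a + √b) * r ^ (-(1 : ℝ) / 2) * G ^ ((3 : ℝ) / 2) +
      (√a + √b) * r ^ (-(7 : ℝ) / 6) * G ^ ((1 : ℝ) / 2) := by
  set P := √a * (r ^ ((1 : ℝ) / 2) * G ^ ((3 : ℝ) / 2)) with hP
  set Q := √b * (r ^ (-(1 : ℝ) / 6) * G ^ ((1 : ℝ) / 2)) with hQ
  have hP0 : 0 ≤ P := by positivity
  have hQ0 : 0 ≤ Q := by positivity
  have hP2 : P ^ 2 = a * r * G ^ 2 * G := by
    rw [hP, mul_pow, mul_pow, Real.sq_sqrt ha, ← Real.rpow_mul_natCast hr.le,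
      ← Real.rpow_mul_natCast hG]
    norm_num
    ring
  have hQ2 : Q ^ 2 = b * r ^ (-(1 : ℝ) / 3) * G := by
    rw [hQ, mul_pow, mul_pow, Real.sq_sqrt hb, ← Real.rpow_mul_natCast hr.le,
      ← Real.rpow_mul_natCast hG]
    norm_num
    ring
  have hX : X ≤ P + Q := by
    refine (le_abs_self X).trans (abs_le_of_sq_le_sq ?_ (by positivity))
    nlinarith [mul_nonneg hP0 hQ0]
  have e1 : r⁻¹ * r ^ ((1 : ℝ) / 2) = r ^ (-(1 : ℝ) / 2) := by
    rw [← Real.rpow_neg_one, ← Real.rpow_add hr]; norm_num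
  have e2 : r⁻¹ * r ^ (-(1 : ℝ) / 6) = r ^ (-(7 : ℝ) / 6) := by
    rw [← Real.rpow_neg_one, ← Real.rpow_add hr]; norm_num
  calc r⁻¹ * X ≤ r⁻¹ * (P + Q) := by gcongr
    _ = √a * (r⁻¹ * r ^ ((1 : ℝ) / 2)) * G ^ ((3 : ℝ) / 2) +
        √b * (r⁻¹ * r ^ (-(1 : ℝ) / 6)) * G ^ ((1 : ℝ) / 2) := by rw [hP, hQ]; ring
    _ ≤ _ := by
      rw [e1, e2]
      gcongr
      · linarith [Real.sqrt_nonneg b]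
      · linarith [Real.sqrt_nonneg a]

/-- The Hall-term estimate, with a constant depending only on the lower bound `c₀` for the mass
of the weight and on the bound `cB` for the weighted mean. -/
theorem exists_hall_term_bound (F : Type*) [NormedAddCommGroup F] [NormedSpace ℝ F]
    [CompleteSpace F] {c₀ cB : ℝ} (hc₀ : 0 < c₀) (hcB : 0 < cB) :
    ∃ c : ℝ, 0 < c ∧ ∀ B : E3 → F, ContDiff ℝ 1 B → ∀ r : ℝ, 0 < r → ∀ ζ : E3 → ℝ,
      Measurable ζ → (∀ x, 0 ≤ ζ x) → (∀ x, ζ x ≤ 1) → c₀ * r ^ 3 ≤ ∫ x in annulus r, ζ x →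
      ‖(∫ x in annulus r, ζ x)⁻¹ • ∫ x in annulus r, ζ x • B x‖ ≤ cB * r ^ (-(5 : ℝ) / 6) →
      r⁻¹ * ∫ x in annulus r, ‖B x‖ ^ 2 * ‖fderiv ℝ B x‖
        ≤ c * r ^ (-(1 : ℝ) / 2) * (∫ x in annulus r, ‖fderiv ℝ B x‖ ^ 2) ^ ((3 : ℝ) / 2)
          + c * r ^ (-(7 : ℝ) / 6) *
            (∫ x in annulus r, ‖fderiv ℝ B x‖ ^ 2) ^ ((1 : ℝ) / 2) := by
  obtain ⟨C, hCt, hC⟩ := exists_lintegral_sub_pow_four_le F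
  set v := (volume (annulus 1)).toReal with hv
  have hvE : volume (annulus 1) = ENNReal.ofReal v :=
    (ENNReal.ofReal_toReal (volume_annulus_ne_top 1)).symm
  have hCE : C = ENNReal.ofReal C.toReal := (ENNReal.ofReal_toReal hCt).symm
  have hv0 : 0 ≤ v := ENNReal.toReal_nonneg
  have hC0 : 0 ≤ C.toReal := ENNReal.toReal_nonneg
  set a := 2 ^ 4 * (c₀⁻¹ ^ 4 * v ^ 3 * C.toReal) with ha
  set b := 2 ^ 4 * (cB ^ 4 * v) with hb
  have ha0 : 0 ≤ a := by positivity
  have hb0 : 0 ≤ b := by positivity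
  refine ⟨√a + √b + 1, by positivity, fun B hB r hr ζ hζ h0 h1 hM hmean => ?_⟩
  set G := ∫ x in annulus r, ‖fderiv ℝ B x‖ ^ 2 with hG
  have hG0 : 0 ≤ G := integral_nonneg fun x => by positivity
  set X := ∫ x in annulus r, ‖B x‖ ^ 2 * ‖fderiv ℝ B x‖ with hX
  have hX0 : 0 ≤ X := integral_nonneg fun x => by positivity
  set m := (∫ x in annulus r, ζ x)⁻¹ • ∫ x in annulus r, ζ x • B x with hm
  have hmE : ‖m‖ₑ ≤ ENNReal.ofReal (cB * r ^ (-(5 : ℝ) / 6)) := by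
    rw [← ofReal_norm]; exact ENNReal.ofReal_le_ofReal hmean
  have hpush (k v C r G q : ℝ) (hk : 0 ≤ k) (hv : 0 ≤ v) (hC : 0 ≤ C) (hr : 0 ≤ r) (hG : 0 ≤ G)
      (hq : 0 ≤ q) : ENNReal.ofReal (2 ^ 4 * (k ^ 4 * v ^ 3 * C * r * G ^ 2 + q ^ 4 * (r ^ 3 * v)))
      = 2 ^ 4 * (ENNReal.ofReal k ^ 4 * ENNReal.ofReal v ^ 3 * ENNReal.ofReal C *
        ENNReal.ofReal r * ENNReal.ofReal G ^ 2 +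
          ENNReal.ofReal q ^ 4 * (ENNReal.ofReal r ^ 3 * ENNReal.ofReal v)) := by
    rw [ENNReal.ofReal_mul (by positivity), ENNReal.ofReal_add (by positivity) (by positivity)]
    repeat rw [ENNReal.ofReal_mul (by positivity)]
    repeat rw [ENNReal.ofReal_pow (by positivity)]
    norm_num
  have hrp : (r ^ (-(5 : ℝ) / 6)) ^ 4 * r ^ 3 = r ^ (-(1 : ℝ) / 3) := by
    rw [← Real.rpow_mul_natCast hr.le, ← Real.rpow_add_natCast hr.ne']; norm_num
  have key : X ^ 2 ≤ (a * r * G ^ 2 + b * r ^ (-(1 : ℝ) / 3)) * G := by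
    rw [← ENNReal.ofReal_le_ofReal_iff (by positivity), ENNReal.ofReal_pow hX0]
    refine (ofReal_integral_mul_sq_le hB r).trans ?_
    rw [← ofReal_integral_fderiv_sq hB, ← hG, ENNReal.ofReal_mul (by positivity)]
    gcongr
    refine (lintegral_pow_four_annulus_le B m hr).trans ?_
    calc _ ≤ 2 ^ 4 * (ENNReal.ofReal c₀⁻¹ ^ 4 * volume (annulus 1) ^ 3 * C * ENNReal.ofReal r *
          (∫⁻ z in annulus r, ‖fderiv ℝ B z‖ₑ ^ 2) ^ 2 +
          ENNReal.ofReal (cB * r ^ (-(5 : ℝ) / 6)) ^ 4 *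
            (ENNReal.ofReal r ^ 3 * volume (annulus 1))) := by
          gcongr
          exact lintegral_sub_weighted_mean_pow_four_le hC hB hr hζ h0 h1 hc₀ hM
      _ = ENNReal.ofReal (2 ^ 4 * (c₀⁻¹ ^ 4 * v ^ 3 * C.toReal * r * G ^ 2 +
          (cB * r ^ (-(5 : ℝ) / 6)) ^ 4 * (r ^ 3 * v))) := by
          rw [← ofReal_integral_fderiv_sq hB, ← hG, hvE]
          nth_rw 1 [hCE]
          refine (hpush _ _ _ _ _ _ (by positivity) hv0 hC0 hr.le hG0 (by positivity)).symm
      _ = _ := by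
          congr 1
          rw [ha, hb, ← hrp]
          ring
  refine (inv_mul_le_of_sq_le hG0 hr ha0 hb0 key).trans ?_
  generalize √a + √b = s
  gcongr <;> linarith

theorem tendsto_inv_mul_of_bound {X G : ℝ → ℝ} {c K : ℝ} (hc : 0 ≤ c) (hX : ∀ r, 0 ≤ X r)
    (hG : ∀ r, 0 ≤ G r) (hGK : ∀ r, G r ≤ K)
    (h : ∀ r, 1 ≤ r → r⁻¹ * X r ≤ c * r ^ (-(1 : ℝ) / 2) * G r ^ ((3 : ℝ) / 2)
      + c * r ^ (-(7 : ℝ) / 6) * G r ^ ((1 : ℝ) / 2)) :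
    Filter.Tendsto (fun r => r⁻¹ * X r) Filter.atTop (nhds 0) := by
  have hlim : Filter.Tendsto (fun r : ℝ => c * r ^ (-(1 / 2 : ℝ)) * K ^ ((3 : ℝ) / 2)
      + c * r ^ (-(7 / 6 : ℝ)) * K ^ ((1 : ℝ) / 2)) Filter.atTop (nhds 0) := by
    have h1 := tendsto_rpow_neg_atTop (y := 1 / 2) (by norm_num)
    have h2 := tendsto_rpow_neg_atTop (y := 7 / 6) (by norm_num)
    simpa using ((h1.const_mul c).mul_const (K ^ ((3 : ℝ) / 2))).add
      ((h2.const_mul c).mul_const (K ^ ((1 : ℝ) / 2)))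
  refine squeeze_zero' ?_ ?_ hlim
  · filter_upwards [Filter.eventually_ge_atTop 1] with r hr
    have := hX r
    positivity
  · filter_upwards [Filter.eventually_ge_atTop 1] with r hr
    refine (h r hr).trans ?_
    have := hG r
    have := hGK r
    rw [neg_div, neg_div]
    gcongr

/-- **Hall-term estimate on annuli.**  If `B ∈ W^{1,2}(A_r)` on the annulus
`A_r = B(3r)\B(2r)` and the weighted mean with respect to a suitable cutoff `ζ` satisfies
`|B_{A_r,ζ}| ≤ c_B r^{-5/6}`, then
`r⁻¹ ∫_{A_r} |B|²|∇B| ≤ c r^{-1/2} (∫_{A_r}|∇B|²)^{3/2} + c r^{-7/6} (∫_{A_r}|∇B|²)^{1/2}`;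
in particular, if `∫_{ℝ³}|∇B|² < ∞` (and such cutoffs exist for every `r ≥ 1`), then
`r⁻¹ ∫_{A_r} |B|²|∇B| → 0` as `r → ∞`. -/
theorem stmt_17 (c₀ cB : ℝ) (hc₀ : 0 < c₀) (hcB : 0 < cB) :
    ∃ c : ℝ, 0 < c ∧
      ∀ B : E3 → Fin 3 → ℝ, ContDiff ℝ 1 B →
        ((∀ r : ℝ, 1 ≤ r → ∀ ζ : E3 → ℝ, Measurable ζ →
            (∀ x, 0 ≤ ζ x) → (∀ x, ζ x ≤ 1) → tsupport ζ ⊆ annulus r →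
            c₀ * r ^ 3 ≤ ∫ x in annulus r, ζ x →
            ‖(∫ x in annulus r, ζ x)⁻¹ • ∫ x in annulus r, ζ x • B x‖ ≤ cB * r ^ (-(5 : ℝ) / 6) →
            r⁻¹ * ∫ x in annulus r, ‖B x‖ ^ 2 * ‖fderiv ℝ B x‖
              ≤ c * r ^ (-(1 : ℝ) / 2)
                  * (∫ x in annulus r, ‖fderiv ℝ B x‖ ^ 2) ^ ((3 : ℝ) / 2)
                + c * r ^ (-(7 : ℝ) / 6)
                  * (∫ x in annulus r, ‖fderiv ℝ B x‖ ^ 2) ^ ((1 : ℝ) / 2)) ∧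
          (Integrable (fun x => ‖fderiv ℝ B x‖ ^ 2) →
            (∀ r : ℝ, 1 ≤ r → ∃ ζ : E3 → ℝ, Measurable ζ ∧
              (∀ x, 0 ≤ ζ x) ∧ (∀ x, ζ x ≤ 1) ∧ tsupport ζ ⊆ annulus r ∧
              c₀ * r ^ 3 ≤ (∫ x in annulus r, ζ x) ∧
              ‖(∫ x in annulus r, ζ x)⁻¹ • ∫ x in annulus r, ζ x • B x‖
                ≤ cB * r ^ (-(5 : ℝ) / 6)) →
            Filter.Tendsto (fun r : ℝ =>
                r⁻¹ * ∫ x in annulus r, ‖B x‖ ^ 2 * ‖fderiv ℝ B x‖)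
              Filter.atTop (nhds 0))) := by
  obtain ⟨c, hc, h⟩ := exists_hall_term_bound (Fin 3 → ℝ) hc₀ hcB
  refine ⟨c, hc, fun B hB => ⟨fun r hr ζ hζ h0 h1 _ hM hmean =>
    h B hB r (by linarith) ζ hζ h0 h1 hM hmean, fun h_int hex => ?_⟩⟩
  refine tendsto_inv_mul_of_bound (G := fun r => ∫ x in annulus r, ‖fderiv ℝ B x‖ ^ 2)
    (K := ∫ x, ‖fderiv ℝ B x‖ ^ 2) hc.le (fun r => integral_nonneg fun x => by positivity)
    (fun r => integral_nonneg fun x => by positivity)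
    (fun r => setIntegral_le_integral h_int (Filter.Eventually.of_forall fun x => by positivity))
    fun r hr => ?_
  obtain ⟨ζ, hζ, h0, h1, _, hM, hmean⟩ := hex r hr
  exact h B hB r (by linarith) ζ hζ h0 h1 hM hmean
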